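/- Let d ≥ 1, M > 0, h ∈ ℝ^d, and let A and H be symmetric d×d real matrices such that H + (M/2)·‖h‖·I is positive semidefinite. Then (−(2/M)·λ_min(A))³ ≤ (32/M³)·‖H − A‖_op³ + 4·‖h‖³. -/

import Mathlib

open scoped RealInnerProductSpace

/-- The spectral (operator) norm of a square real matrix. -/
noncomputable def matOpNorm {d : ℕ} (A : Matrix (Fin d) (Fin d) ℝ) : ℝ :=
  ‖Matrix.toEuclideanCLM (𝕜 := ℝ) A‖

/-- The smallest eigenvalue of a symmetric matrix `A`, as the infimum of `⟪A v, v⟫` over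
unit vectors `v`. -/
noncomputable def lambdaMin {d : ℕ} (A : Matrix (Fin d) (Fin d) ℝ) : ℝ :=
  sInf {r : ℝ | ∃ v : EuclideanSpace ℝ (Fin d), ‖v‖ = 1 ∧
    r = ⟪(Matrix.toEuclideanCLM (𝕜 := ℝ) A) v, v⟫}

theorem le_lambdaMin {d : ℕ} (hd : 1 ≤ d) (A : Matrix (Fin d) (Fin d) ℝ) (c : ℝ)
    (hc : ∀ v : EuclideanSpace ℝ (Fin d), ‖v‖ = 1 →
      c ≤ ⟪(Matrix.toEuclideanCLM (𝕜 := ℝ) A) v, v⟫) :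
    c ≤ lambdaMin A := by
  refine le_csInf ⟨_, EuclideanSpace.single ⟨0, hd⟩ (1 : ℝ), by simp, rfl⟩ ?_
  rintro _ ⟨v, hv, rfl⟩
  exact hc v hv

theorem inner_toEuclideanCLM_le_matOpNorm {d : ℕ} (A : Matrix (Fin d) (Fin d) ℝ)
    (v : EuclideanSpace ℝ (Fin d)) (hv : ‖v‖ = 1) :
    ⟪(Matrix.toEuclideanCLM (𝕜 := ℝ) A) v, v⟫ ≤ matOpNorm A := by
  calc ⟪(Matrix.toEuclideanCLM (𝕜 := ℝ) A) v, v⟫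
      ≤ ‖(Matrix.toEuclideanCLM (𝕜 := ℝ) A) v‖ * ‖v‖ := real_inner_le_norm _ _
    _ ≤ matOpNorm A := by
      simpa [hv, matOpNorm] using (Matrix.toEuclideanCLM (𝕜 := ℝ) A).le_opNorm v

/-- If `H + c I ⪰ 0`, then `λ_min(A) ≥ -(‖H - A‖ + c)`. -/
theorem neg_le_lambdaMin_of_posSemidef_add_smul_one {d : ℕ} (hd : 1 ≤ d) (c : ℝ)
    (A H : Matrix (Fin d) (Fin d) ℝ)
    (hpsd : (H + c • (1 : Matrix (Fin d) (Fin d) ℝ)).PosSemidef) :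
    -(matOpNorm (H - A) + c) ≤ lambdaMin A := by
  refine le_lambdaMin hd A _ fun v hv => ?_
  have hnonneg := hpsd.dotProduct_mulVec_nonneg v.ofLp
  rw [star_trivial, ← Matrix.inner_toEuclideanCLM, real_inner_comm] at hnonneg
  have hdiff := inner_toEuclideanCLM_le_matOpNorm (H - A) v hv
  simp only [map_add, map_sub, map_smul, map_one, add_apply,
    sub_apply, smul_apply,
    one_apply_eq_self, inner_add_left, inner_sub_left, real_inner_smul_left,
    real_inner_self_eq_norm_sq, hv] at hnonneg hdiff
  linarith

/-- **Minimum-eigenvalue bound from the second-order cubic optimality condition.**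
If `H + (M/2)‖h‖ I ⪰ 0` for symmetric matrices `A, H` and `M > 0`, then
`(−(2/M) λ_min(A))³ ≤ (32/M³)‖H − A‖_op³ + 4‖h‖³`. -/
theorem lambdaMin_bound_from_cubic_psd
    (d : ℕ) (hd : 1 ≤ d) (M : ℝ) (hM : 0 < M)
    (h : EuclideanSpace ℝ (Fin d))
    (A H : Matrix (Fin d) (Fin d) ℝ)
    (hA : A.IsHermitian) (hH : H.IsHermitian)
    (hpsd : (H + ((M / 2) * ‖h‖) • (1 : Matrix (Fin d) (Fin d) ℝ)).PosSemidef) :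
    (-(2 / M) * lambdaMin A) ^ 3 ≤ (32 / M ^ 3) * (matOpNorm (H - A)) ^ 3 + 4 * ‖h‖ ^ 3 := by
  have hmin := neg_le_lambdaMin_of_posSemidef_add_smul_one hd _ A H hpsd
  have hop : 0 ≤ matOpNorm (H - A) := norm_nonneg _
  have hle : -(2 / M) * lambdaMin A ≤ 2 / M * matOpNorm (H - A) + ‖h‖ := by
    calc -(2 / M) * lambdaMin A = 2 / M * -lambdaMin A := by ring
      _ ≤ 2 / M * (matOpNorm (H - A) + M / 2 * ‖h‖) := by gcongr; linarith
      _ = 2 / M * matOpNorm (H - A) + ‖h‖ := by field_simp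
  calc (-(2 / M) * lambdaMin A) ^ 3
      ≤ (2 / M * matOpNorm (H - A) + ‖h‖) ^ 3 := (Odd.strictMono_pow (by decide)).monotone hle
    _ ≤ 2 ^ (3 - 1) * ((2 / M * matOpNorm (H - A)) ^ 3 + ‖h‖ ^ 3) :=
      add_pow_le (by positivity) (norm_nonneg h) 3
    _ = (32 / M ^ 3) * (matOpNorm (H - A)) ^ 3 + 4 * ‖h‖ ^ 3 := by ring
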